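/- arXiv:2509.05922 — 9 statements merged into one kernel-verified Lean document; each statement's English description precedes it below -/
import Mathlib

section
/- Let r : ℝ → E → ℝ be measurable such that for ν-a.e. x the section d ↦ r d x is differentiable with derivative ∂_d r, the sections d ↦ (∂_d p) d x · r d x and d ↦ p d x · (∂_d r) d x are Lebesgue-integrable on ℝ, and r d x · p d x tends to 0 as d → +∞ and as d → −∞. Assume moreover that (d,x) ↦ (∂_d p) d x · r d x and (d,x) ↦ p d x · (∂_d r) d x are integrable with respect to the product measure volume ⊗ ν. Then ∫ (∂_d r) d x · p d x ∂(volume ⊗ ν) = − ∫ (∂_d p) d x · r d x ∂(volume ⊗ ν). (This is the fiberwise integration-by-parts identity underlying the Neyman orthogonality of the general APE score with respect to the outcome model l in Proposition 1.) -/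
open MeasureTheory Filter

/-- Fiberwise integration by parts: for a σ-finite measure `ν` on `E`, a nonnegative
measurable density `p : ℝ → E → ℝ` with fiberwise derivative `p'`, and a measurable
`r : ℝ → E → ℝ` with fiberwise derivative `r'`, under fiberwise integrability and the
vanishing of `r d x * p d x` at `±∞`, together with product integrability of both
integrands, we have
`∫ r' d x * p d x ∂(volume ⊗ ν) = - ∫ p' d x * r d x ∂(volume ⊗ ν)`. -/
theorem fiberwise_integration_by_parts
    {E : Type*} [MeasurableSpace E] (ν : Measure E) [SigmaFinite ν]
    (p p' : ℝ → E → ℝ)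
    (hp_meas : Measurable (Function.uncurry p))
    (hp_nonneg : ∀ d x, 0 ≤ p d x)
    (hp_diff : ∀ᵐ x ∂ν, ∀ d : ℝ, HasDerivAt (fun s => p s x) (p' d x) d)
    (r r' : ℝ → E → ℝ)
    (hr_meas : Measurable (Function.uncurry r))
    (hr_diff : ∀ᵐ x ∂ν, ∀ d : ℝ, HasDerivAt (fun s => r s x) (r' d x) d)
    (h_sec1 : ∀ᵐ x ∂ν, Integrable (fun d => p' d x * r d x))
    (h_sec2 : ∀ᵐ x ∂ν, Integrable (fun d => p d x * r' d x))
    (h_top : ∀ᵐ x ∂ν, Tendsto (fun d => r d x * p d x) atTop (nhds 0))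
    (h_bot : ∀ᵐ x ∂ν, Tendsto (fun d => r d x * p d x) atBot (nhds 0))
    (h_prod1 : Integrable (fun q : ℝ × E => p' q.1 q.2 * r q.1 q.2) (volume.prod ν))
    (h_prod2 : Integrable (fun q : ℝ × E => p q.1 q.2 * r' q.1 q.2) (volume.prod ν)) :
    ∫ q : ℝ × E, r' q.1 q.2 * p q.1 q.2 ∂(volume.prod ν) =
      - ∫ q : ℝ × E, p' q.1 q.2 * r q.1 q.2 ∂(volume.prod ν) := by
  have hcomm : (fun q : ℝ × E => r' q.1 q.2 * p q.1 q.2) =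
      fun q : ℝ × E => p q.1 q.2 * r' q.1 q.2 := by
    funext q
    exact mul_comm _ _
  rw [hcomm, integral_prod_symm _ h_prod2, integral_prod_symm _ h_prod1, ← integral_neg]
  apply integral_congr_ae
  filter_upwards [hp_diff, hr_diff, h_sec1, h_sec2, h_top, h_bot] with x hp hr h1 h2 ht hb
  have hd : ∀ d, HasDerivAt (fun s => r s x * p s x) (p d x * r' d x + p' d x * r d x) d := by
    intro d
    have h := (hr d).mul (hp d)
    exact h.congr_deriv (by ring)
  have h := integral_of_hasDerivAt_of_tendsto hd (h2.add h1) hb ht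
  rw [integral_add h2 h1] at h
  linarith
end

section
/- Assume the law of (D, X) satisfies Measure.map (fun ω => (D ω, X ω)) μ = (volume.prod ν).withDensity (fun q => ENNReal.ofReal (p q.1 q.2)) with p d x > 0 for every d and ν-a.e. x. Let r : ℝ → E → ℝ be measurable such that for ν-a.e. x the section d ↦ r d x is differentiable with derivative ∂_d r, r d x · p d x → 0 as d → +∞ and as d → −∞, and (d,x) ↦ (∂_d p) d x · r d x and (d,x) ↦ p d x · (∂_d r) d x are (volume ⊗ ν)-integrable. Let g : ℝ → E → ℝ be measurable (representing the partial derivative ∂_d l₀) and assume ω ↦ g (D ω) (X ω), ω ↦ ((∂_d p)/p)(D ω, X ω) · (Y ω − l₀ (D ω) (X ω)), ω ↦ (∂_d r)(D ω, X ω), and ω ↦ ((∂_d p)/p)(D ω, X ω) · r (D ω) (X ω) are μ-integrable. Then for every θ₀ ∈ ℝ, the map t ↦ ∫ ( g (D ω) (X ω) + t · (∂_d r)(D ω, X ω) − θ₀ − ((∂_d p)/p)(D ω, X ω) · (Y ω − l₀ (D ω) (X ω) − t · r (D ω) (X ω)) ) ∂μ is constant in t; in particular its derivative at t = 0 is 0.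 (Neyman orthogonality of the general APE score with respect to the outcome model, Proposition 1, part 1.) -/
open MeasureTheory Filter

/-- Neyman orthogonality of the general APE score with respect to the outcome model
(Proposition 1, part 1): under the conditional moment restriction
`E[Y | D, X] = l₀(D, X)` and the density representation of the law of `(D, X)`,
for any perturbation direction `r` of the outcome model (with fiberwise derivative `r'`,
vanishing tails `r·p → 0` and product integrability), the expected perturbed score
`t ↦ E[ g(D,X) + t·r'(D,X) - θ₀ - (p'/p)(D,X)·(Y - l₀(D,X) - t·r(D,X)) ]`
is constant in `t`, and in particular its derivative at `t = 0` is `0`. -/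
theorem general_APE_score_orthogonal_outcome
    {Ω E : Type*} [MeasurableSpace Ω] [MeasurableSpace E]
    (μ : Measure Ω) [IsProbabilityMeasure μ]
    (X : Ω → E) (D Y : Ω → ℝ)
    (hX : Measurable X) (hD : Measurable D) (hY : Measurable Y)
    (l₀ : ℝ → E → ℝ) (hl₀ : Measurable (Function.uncurry l₀))
    (hY_int : Integrable Y μ)
    (hl₀_int : Integrable (fun ω => l₀ (D ω) (X ω)) μ)
    (h_cond : μ[Y | MeasurableSpace.comap (fun ω => (D ω, X ω)) inferInstance]
        =ᵐ[μ] fun ω => l₀ (D ω) (X ω))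
    (ν : Measure E) [SigmaFinite ν]
    (p p' : ℝ → E → ℝ)
    (hp_meas : Measurable (Function.uncurry p))
    (hp_nonneg : ∀ d x, 0 ≤ p d x)
    (hp_diff : ∀ᵐ x ∂ν, ∀ d : ℝ, HasDerivAt (fun s => p s x) (p' d x) d)
    (h_law : Measure.map (fun ω => (D ω, X ω)) μ =
      (volume.prod ν).withDensity (fun q => ENNReal.ofReal (p q.1 q.2)))
    (hp_pos : ∀ d : ℝ, ∀ᵐ x ∂ν, 0 < p d x)
    (r r' : ℝ → E → ℝ)
    (hr_meas : Measurable (Function.uncurry r))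
    (hr_diff : ∀ᵐ x ∂ν, ∀ d : ℝ, HasDerivAt (fun s => r s x) (r' d x) d)
    (h_top : ∀ᵐ x ∂ν, Tendsto (fun d => r d x * p d x) atTop (nhds 0))
    (h_bot : ∀ᵐ x ∂ν, Tendsto (fun d => r d x * p d x) atBot (nhds 0))
    (h_prod1 : Integrable (fun q : ℝ × E => p' q.1 q.2 * r q.1 q.2) (volume.prod ν))
    (h_prod2 : Integrable (fun q : ℝ × E => p q.1 q.2 * r' q.1 q.2) (volume.prod ν))
    (g : ℝ → E → ℝ) (hg : Measurable (Function.uncurry g))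
    (hg_int : Integrable (fun ω => g (D ω) (X ω)) μ)
    (h_corr_int : Integrable
      (fun ω => p' (D ω) (X ω) / p (D ω) (X ω) * (Y ω - l₀ (D ω) (X ω))) μ)
    (hr'_int : Integrable (fun ω => r' (D ω) (X ω)) μ)
    (hcorr_r_int : Integrable
      (fun ω => p' (D ω) (X ω) / p (D ω) (X ω) * r (D ω) (X ω)) μ) :
    ∀ θ₀ : ℝ,
      (∀ t : ℝ,
        (∫ ω, (g (D ω) (X ω) + t * r' (D ω) (X ω) - θ₀ -
          p' (D ω) (X ω) / p (D ω) (X ω) *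
            (Y ω - l₀ (D ω) (X ω) - t * r (D ω) (X ω))) ∂μ) =
        ∫ ω, (g (D ω) (X ω) - θ₀ -
          p' (D ω) (X ω) / p (D ω) (X ω) * (Y ω - l₀ (D ω) (X ω))) ∂μ) ∧
      deriv (fun t : ℝ =>
        ∫ ω, (g (D ω) (X ω) + t * r' (D ω) (X ω) - θ₀ -
          p' (D ω) (X ω) / p (D ω) (X ω) *
            (Y ω - l₀ (D ω) (X ω) - t * r (D ω) (X ω))) ∂μ) 0 = 0 := by
  have hDX : Measurable (fun ω => (D ω, X ω)) := hD.prodMk hX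
  have hpos : ∀ᵐ q ∂((volume : Measure ℝ).prod ν), 0 < p q.1 q.2 := by
    have hm : MeasurableSet {q : ℝ × E | 0 < p q.1 q.2} :=
      measurableSet_lt measurable_const hp_meas
    exact (Measure.ae_prod_iff_ae_ae hm).2 (Filter.Eventually.of_forall hp_pos)
  have hsum : Integrable (fun q : ℝ × E => p' q.1 q.2 * r q.1 q.2 + p q.1 q.2 * r' q.1 q.2)
      ((volume : Measure ℝ).prod ν) := h_prod1.add h_prod2
  have hzero : ∫ q, (p' q.1 q.2 * r q.1 q.2 + p q.1 q.2 * r' q.1 q.2)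
      ∂((volume : Measure ℝ).prod ν) = 0 := by
    rw [integral_prod_symm _ hsum]
    apply integral_eq_zero_of_ae
    filter_upwards [hsum.prod_left_ae, hp_diff, hr_diff, h_top, h_bot] with x h1 h2 h3 h4 h5
    have := integral_of_hasDerivAt_of_tendsto (f := fun d => r d x * p d x)
      (f' := fun d => p' d x * r d x + p d x * r' d x) (m := 0) (n := 0)
      (fun d => by
        exact ((h3 d).fun_mul (h2 d)).congr_deriv (by ring)) h1 h5 h4
    simpa using this
  let h : ℝ × E → ℝ := fun q => r' q.1 q.2 + p' q.1 q.2 / p q.1 q.2 * r q.1 q.2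
  have hae : h =ᵐ[(volume : Measure ℝ).prod ν]
      fun q => (p' q.1 q.2 * r q.1 q.2 + p q.1 q.2 * r' q.1 q.2) / p q.1 q.2 := by
    filter_upwards [hpos] with q hq
    simp only [h]
    field_simp
    ring
  have hpm : Measurable (fun q : ℝ × E => p q.1 q.2) := hp_meas
  have hasm : AEStronglyMeasurable h ((volume : Measure ℝ).prod ν) := by
    refine AEStronglyMeasurable.congr ?_ hae.symm
    exact (hsum.aestronglyMeasurable.aemeasurable.div hpm.aemeasurable).aestronglyMeasurable
  have hasm' : AEStronglyMeasurable h (Measure.map (fun ω => (D ω, X ω)) μ) := by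
    rw [h_law]
    exact hasm.mono_ac (withDensity_absolutelyContinuous _ _)
  have key : ∫ ω, (r' (D ω) (X ω) + p' (D ω) (X ω) / p (D ω) (X ω) * r (D ω) (X ω)) ∂μ = 0 := by
    have e1 := integral_map hDX.aemeasurable hasm'
    change ∫ ω, h (D ω, X ω) ∂μ = 0
    rw [← e1, h_law, integral_withDensity_eq_integral_toReal_smul hpm.ennreal_ofReal
      (Filter.Eventually.of_forall fun _ => ENNReal.ofReal_lt_top), ← hzero]
    apply integral_congr_ae
    filter_upwards [hpos] with q hq
    simp only [h, smul_eq_mul, ENNReal.toReal_ofReal hq.le]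
    field_simp
    ring
  intro θ₀
  have main : ∀ t : ℝ,
        (∫ ω, (g (D ω) (X ω) + t * r' (D ω) (X ω) - θ₀ -
          p' (D ω) (X ω) / p (D ω) (X ω) *
            (Y ω - l₀ (D ω) (X ω) - t * r (D ω) (X ω))) ∂μ) =
        ∫ ω, (g (D ω) (X ω) - θ₀ -
          p' (D ω) (X ω) / p (D ω) (X ω) * (Y ω - l₀ (D ω) (X ω))) ∂μ := by
    intro t
    have i1 : Integrable (fun ω => g (D ω) (X ω) - θ₀ -
          p' (D ω) (X ω) / p (D ω) (X ω) * (Y ω - l₀ (D ω) (X ω))) μ :=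
      (hg_int.sub (integrable_const θ₀)).sub h_corr_int
    have i2 : Integrable (fun ω => t * (r' (D ω) (X ω) +
        p' (D ω) (X ω) / p (D ω) (X ω) * r (D ω) (X ω))) μ :=
      (hr'_int.add hcorr_r_int).const_mul t
    have e := integral_add i1 i2
    rw [integral_const_mul, key, mul_zero, add_zero] at e
    rw [← e]
    congr 1
    ext ω
    ring
  refine ⟨main, ?_⟩
  simp_rw [main]
  simp
end

section
/- Let h : ℝ → E → ℝ be measurable such that ω ↦ h (D ω) (X ω) · (Y ω − l₀ (D ω) (X ω)) is μ-integrable. Then ∫ h (D ω) (X ω) · (Y ω − l₀ (D ω) (X ω)) ∂μ = 0. In particular, taking h to be the partial derivative ∂_d (r_p / p₀) of a perturbation of the conditional treatment density, the Gateaux derivative of the expected APE score with respect to the treatment density vanishes at the truth. (Proposition 1, part 2: Neyman orthogonality with respect to the density model p.) -/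
open MeasureTheory

/-- Proposition 1, part 2 (Neyman orthogonality with respect to the density model):
under the conditional moment restriction `E[Y | D, X] = l₀(D, X)`, for any measurable
`h : ℝ → E → ℝ` such that `ω ↦ h (D ω) (X ω) * (Y ω - l₀ (D ω) (X ω))` is `μ`-integrable,
`∫ h (D ω) (X ω) * (Y ω - l₀ (D ω) (X ω)) ∂μ = 0`. -/
theorem general_APE_score_orthogonal_density
    {Ω E : Type*} [MeasurableSpace Ω] [MeasurableSpace E]
    (μ : Measure Ω) [IsProbabilityMeasure μ]
    (X : Ω → E) (D Y : Ω → ℝ)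
    (hX : Measurable X) (hD : Measurable D) (hY : Measurable Y)
    (l₀ : ℝ → E → ℝ) (hl₀ : Measurable (Function.uncurry l₀))
    (hY_int : Integrable Y μ)
    (hl₀_int : Integrable (fun ω => l₀ (D ω) (X ω)) μ)
    (h_cond : μ[Y | MeasurableSpace.comap (fun ω => (D ω, X ω)) inferInstance]
        =ᵐ[μ] fun ω => l₀ (D ω) (X ω))
    (h : ℝ → E → ℝ) (hh : Measurable (Function.uncurry h))
    (h_int : Integrable (fun ω => h (D ω) (X ω) * (Y ω - l₀ (D ω) (X ω))) μ) :
    ∫ ω, h (D ω) (X ω) * (Y ω - l₀ (D ω) (X ω)) ∂μ = 0 := by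
  have hm : MeasurableSpace.comap (fun ω => (D ω, X ω)) inferInstance ≤ ‹MeasurableSpace Ω› :=
    (hD.prodMk hX).comap_le
  have key : ∀ g : ℝ → E → ℝ, Measurable (Function.uncurry g) →
      StronglyMeasurable[MeasurableSpace.comap (fun ω => (D ω, X ω)) inferInstance]
        (fun ω => g (D ω) (X ω)) := fun g hg =>
    (hg.comp (comap_measurable (fun ω => (D ω, X ω)))).stronglyMeasurable
  have h0 : μ[fun ω => Y ω - l₀ (D ω) (X ω) |
      MeasurableSpace.comap (fun ω => (D ω, X ω)) inferInstance] =ᵐ[μ] 0 := by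
    have h1 := condExp_sub hY_int hl₀_int
      (MeasurableSpace.comap (fun ω => (D ω, X ω)) inferInstance)
    rw [condExp_of_stronglyMeasurable hm (key l₀ hl₀) hl₀_int] at h1
    refine h1.trans ?_
    filter_upwards [h_cond] with ω hω
    simp [hω]
  have h2 := condExp_mul_of_stronglyMeasurable_left (key h hh) h_int (hY_int.sub hl₀_int)
  rw [← integral_condExp hm]
  refine integral_eq_zero_of_ae (h2.trans ?_)
  filter_upwards [h0] with ω hω
  have hω' : (μ[Y - fun ω => l₀ (D ω) (X ω) |
      MeasurableSpace.comap (fun ω => (D ω, X ω)) inferInstance]) ω = 0 := hω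
  simp only [Pi.mul_apply, Pi.zero_apply]
  exact mul_eq_zero_of_right _ hω'
end

section
/- Let m₀, v₀, r_m : E → ℝ be measurable with v₀ x ≠ 0 for all x, and assume ω ↦ ((D ω − m₀ (X ω))/v₀ (X ω)) · (Y ω − l₀ (D ω) (X ω)) and ω ↦ (r_m (X ω)/v₀ (X ω)) · (Y ω − l₀ (D ω) (X ω)) are μ-integrable. Then for every t ∈ ℝ, ∫ ((D ω − (m₀ (X ω) + t · r_m (X ω)))/v₀ (X ω)) · (Y ω − l₀ (D ω) (X ω)) ∂μ = 0; in particular the expectation of the practical APE score ψ(W; θ₀, l₀, m₀ + t·r_m, v₀) is constant in t and its derivative at t = 0 is 0. (Neyman orthogonality of the practical APE score with respect to the treatment mean model m.) -/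
open MeasureTheory

/-- Neyman orthogonality of the practical APE score with respect to the treatment mean
model `m`: under the conditional moment restriction `E[Y | D, X] = l₀(D, X)`, for
measurable `m₀, v₀, r_m : E → ℝ` with `v₀ x ≠ 0` and the stated integrability, for every
`t : ℝ` the correction term of the perturbed score integrates to zero:
`∫ ((D - (m₀(X) + t·r_m(X)))/v₀(X)) · (Y - l₀(D, X)) ∂μ = 0`; in particular the
expectation of the practical APE score is constant in `t` with derivative `0` at `t = 0`. -/
theorem practical_APE_score_orthogonal_mean
    {Ω E : Type*} [MeasurableSpace Ω] [MeasurableSpace E]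
    (μ : Measure Ω) [IsProbabilityMeasure μ]
    (X : Ω → E) (D Y : Ω → ℝ)
    (hX : Measurable X) (hD : Measurable D) (hY : Measurable Y)
    (l₀ : ℝ → E → ℝ) (hl₀ : Measurable (Function.uncurry l₀))
    (hY_int : Integrable Y μ)
    (hl₀_int : Integrable (fun ω => l₀ (D ω) (X ω)) μ)
    (h_cond : μ[Y | MeasurableSpace.comap (fun ω => (D ω, X ω)) inferInstance]
        =ᵐ[μ] fun ω => l₀ (D ω) (X ω))
    (m₀ v₀ r_m : E → ℝ)
    (hm₀ : Measurable m₀) (hv₀ : Measurable v₀) (hr_m : Measurable r_m)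
    (hv₀_ne : ∀ x, v₀ x ≠ 0)
    (h_int₁ : Integrable
      (fun ω => (D ω - m₀ (X ω)) / v₀ (X ω) * (Y ω - l₀ (D ω) (X ω))) μ)
    (h_int₂ : Integrable
      (fun ω => r_m (X ω) / v₀ (X ω) * (Y ω - l₀ (D ω) (X ω))) μ) :
    ∀ t : ℝ,
      ∫ ω, (D ω - (m₀ (X ω) + t * r_m (X ω))) / v₀ (X ω) *
        (Y ω - l₀ (D ω) (X ω)) ∂μ = 0 := by
  intro t
  have hDX : Measurable (fun ω => (D ω, X ω)) := hD.prodMk hX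
  have hm := hDX.comap_le
  have key : ∀ g : ℝ × E → ℝ, Measurable g →
      Integrable (fun ω => g (D ω, X ω) * (Y ω - l₀ (D ω) (X ω))) μ →
      ∫ ω, g (D ω, X ω) * (Y ω - l₀ (D ω) (X ω)) ∂μ = 0 := by
    intro g hg hint
    have hcm : ∀ f : ℝ × E → ℝ, Measurable f →
        StronglyMeasurable[MeasurableSpace.comap (fun ω => (D ω, X ω)) inferInstance]
          (fun ω => f (D ω, X ω)) := fun f hf =>
      (hf.comp (comap_measurable (fun ω => (D ω, X ω)))).stronglyMeasurable
    have h1 := condExp_mul_of_stronglyMeasurable_left (μ := μ) (hcm g hg) hint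
      (hY_int.sub hl₀_int)
    have h2 := condExp_sub (μ := μ) hY_int hl₀_int
      (MeasurableSpace.comap (fun ω => (D ω, X ω)) inferInstance)
    have h3 := condExp_of_stronglyMeasurable (μ := μ) hm (hcm _ hl₀) hl₀_int
    rw [← integral_condExp hm]
    refine integral_eq_zero_of_ae ?_
    filter_upwards [h1, h2, h_cond] with ω a b c
    refine Eq.trans a ?_
    have h4 := congrFun h3 ω
    simp only [Function.uncurry] at h4
    rw [Pi.mul_apply]
    refine mul_eq_zero_of_right _ (Eq.trans b ?_)
    rw [Pi.sub_apply, c, h4, sub_self]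
  have k1 := key (fun p => (p.1 - m₀ p.2) / v₀ p.2) (by fun_prop) h_int₁
  have k2 := key (fun p => r_m p.2 / v₀ p.2) (by fun_prop) h_int₂
  have e : (fun ω => (D ω - (m₀ (X ω) + t * r_m (X ω))) / v₀ (X ω) *
        (Y ω - l₀ (D ω) (X ω))) = fun ω =>
      (D ω - m₀ (X ω)) / v₀ (X ω) * (Y ω - l₀ (D ω) (X ω)) -
        t * (r_m (X ω) / v₀ (X ω) * (Y ω - l₀ (D ω) (X ω))) := by
    funext ω
    ring
  rw [e, integral_sub h_int₁ (h_int₂.const_mul t), integral_const_mul]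
  simp only at k1 k2
  rw [k1, k2]
  simp
end

section
/- Let m₀, v₀, r_v : E → ℝ be measurable with v₀ x ≠ 0 for all x, and assume ω ↦ ((D ω − m₀ (X ω)) · r_v (X ω) / (v₀ (X ω))^2) · (Y ω − l₀ (D ω) (X ω)) is μ-integrable. Then ∫ ((D ω − m₀ (X ω)) · r_v (X ω) / (v₀ (X ω))^2) · (Y ω − l₀ (D ω) (X ω)) ∂μ = 0; equivalently, the Gateaux derivative of the expected practical APE score with respect to the conditional variance model v vanishes at v₀. (Neyman orthogonality of the practical APE score with respect to v.) -/
open MeasureTheory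

/-- Neyman orthogonality of the practical APE score with respect to the conditional
variance model `v`: under the conditional moment restriction `E[Y | D, X] = l₀(D, X)`,
for measurable `m₀, v₀, r_v : E → ℝ` with `v₀ x ≠ 0` and the stated integrability,
`∫ ((D - m₀(X)) · r_v(X) / v₀(X)^2) · (Y - l₀(D, X)) ∂μ = 0`; equivalently, the Gateaux
derivative of the expected practical APE score with respect to `v` vanishes at `v₀`. -/
theorem practical_APE_score_orthogonal_variance
    {Ω E : Type*} [MeasurableSpace Ω] [MeasurableSpace E]
    (μ : Measure Ω) [IsProbabilityMeasure μ]
    (X : Ω → E) (D Y : Ω → ℝ)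
    (hX : Measurable X) (hD : Measurable D) (hY : Measurable Y)
    (l₀ : ℝ → E → ℝ) (hl₀ : Measurable (Function.uncurry l₀))
    (hY_int : Integrable Y μ)
    (hl₀_int : Integrable (fun ω => l₀ (D ω) (X ω)) μ)
    (h_cond : μ[Y | MeasurableSpace.comap (fun ω => (D ω, X ω)) inferInstance]
        =ᵐ[μ] fun ω => l₀ (D ω) (X ω))
    (m₀ v₀ r_v : E → ℝ)
    (hm₀ : Measurable m₀) (hv₀ : Measurable v₀) (hr_v : Measurable r_v)
    (hv₀_ne : ∀ x, v₀ x ≠ 0)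
    (h_int : Integrable
      (fun ω => (D ω - m₀ (X ω)) * r_v (X ω) / (v₀ (X ω)) ^ 2 *
        (Y ω - l₀ (D ω) (X ω))) μ) :
    ∫ ω, (D ω - m₀ (X ω)) * r_v (X ω) / (v₀ (X ω)) ^ 2 *
      (Y ω - l₀ (D ω) (X ω)) ∂μ = 0 := by
  have hm : MeasurableSpace.comap (fun ω => (D ω, X ω)) inferInstance ≤
      (inferInstance : MeasurableSpace Ω) := (hD.prodMk hX).comap_le
  have hl : StronglyMeasurable[MeasurableSpace.comap (fun ω => (D ω, X ω)) inferInstance]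
      (fun ω => l₀ (D ω) (X ω)) :=
    (hl₀.comp (comap_measurable (fun ω => (D ω, X ω)))).stronglyMeasurable
  have hgm : Measurable (fun p : ℝ × E => (p.1 - m₀ p.2) * r_v p.2 / (v₀ p.2) ^ 2) := by
    fun_prop
  have hg : StronglyMeasurable[MeasurableSpace.comap (fun ω => (D ω, X ω)) inferInstance]
      (fun ω => (D ω - m₀ (X ω)) * r_v (X ω) / (v₀ (X ω)) ^ 2) :=
    (hgm.comp (comap_measurable (fun ω => (D ω, X ω)))).stronglyMeasurable
  have h1 := condExp_mul_of_stronglyMeasurable_left (μ := μ)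
    (g := fun ω => Y ω - l₀ (D ω) (X ω)) hg h_int (hY_int.sub hl₀_int)
  have h2 := condExp_sub (μ := μ) hY_int hl₀_int
    (MeasurableSpace.comap (fun ω => (D ω, X ω)) inferInstance)
  rw [condExp_of_stronglyMeasurable hm hl hl₀_int] at h2
  rw [← integral_condExp hm]
  refine integral_eq_zero_of_ae ?_
  refine h1.trans ?_
  filter_upwards [h2, h_cond] with ω a b
  have c : (μ[fun ω => Y ω - l₀ (D ω) (X ω) |
      MeasurableSpace.comap (fun ω => (D ω, X ω)) inferInstance]) ω = 0 := by
    refine Eq.trans a ?_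
    simp [b]
  simp [c]
end

section
/- Let m₀ : E → ℝ be measurable and assume ω ↦ (D ω − m₀ (X ω)) · (Y ω − l₀ (D ω) (X ω)) is μ-integrable. Then the conditional expectation of (D − m₀(X)) · (Y − l₀(D, X)) given σ(X) := MeasurableSpace.comap X inferInstance vanishes almost everywhere: μ[(fun ω => (D ω − m₀ (X ω)) · (Y ω − l₀ (D ω) (X ω))) | σ(X)] =ᵐ[μ] 0. (The intermediate conditional-moment lemma used in the proof of Neyman orthogonality of the practical APE score with respect to the variance model v.) -/
open MeasureTheory

/-- The intermediate conditional-moment lemma for orthogonality with respect to the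
variance model: under the conditional moment restriction `E[Y | D, X] = l₀(D, X)`, for
any measurable `m₀ : E → ℝ` with `(D - m₀(X)) · (Y - l₀(D, X))` integrable, the
conditional expectation of `(D - m₀(X)) · (Y - l₀(D, X))` given `σ(X)` vanishes
almost everywhere. -/
theorem condExp_deviation_residual_eq_zero
    {Ω E : Type*} [MeasurableSpace Ω] [MeasurableSpace E]
    (μ : Measure Ω) [IsProbabilityMeasure μ]
    (X : Ω → E) (D Y : Ω → ℝ)
    (hX : Measurable X) (hD : Measurable D) (hY : Measurable Y)
    (l₀ : ℝ → E → ℝ) (hl₀ : Measurable (Function.uncurry l₀))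
    (hY_int : Integrable Y μ)
    (hl₀_int : Integrable (fun ω => l₀ (D ω) (X ω)) μ)
    (h_cond : μ[Y | MeasurableSpace.comap (fun ω => (D ω, X ω)) inferInstance]
        =ᵐ[μ] fun ω => l₀ (D ω) (X ω))
    (m₀ : E → ℝ) (hm₀ : Measurable m₀)
    (h_int : Integrable (fun ω => (D ω - m₀ (X ω)) * (Y ω - l₀ (D ω) (X ω))) μ) :
    μ[(fun ω => (D ω - m₀ (X ω)) * (Y ω - l₀ (D ω) (X ω))) |
        MeasurableSpace.comap X inferInstance] =ᵐ[μ] 0 := by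
  have hDX : Measurable (fun ω => (D ω, X ω)) := hD.prodMk hX
  set m : MeasurableSpace Ω :=
    MeasurableSpace.comap (fun ω => (D ω, X ω)) inferInstance with hm_def
  have hm : m ≤ _ := hDX.comap_le
  have hpair : Measurable[m] (fun ω => (D ω, X ω)) := comap_measurable _
  have hXm : MeasurableSpace.comap X inferInstance ≤ m :=
    (measurable_snd.comp hpair).comap_le
  have hf : StronglyMeasurable[m] (fun ω => D ω - m₀ (X ω)) :=
    (((measurable_fst.sub (hm₀.comp measurable_snd)) :
      Measurable (fun p : ℝ × E => p.1 - m₀ p.2)).comp hpair).stronglyMeasurable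
  have hl : StronglyMeasurable[m] (fun ω => l₀ (D ω) (X ω)) :=
    (hl₀.comp hpair).stronglyMeasurable
  have hg : μ[(fun ω => Y ω - l₀ (D ω) (X ω)) | m] =ᵐ[μ] 0 := by
    have h1 := condExp_sub hY_int hl₀_int m
    rw [condExp_of_stronglyMeasurable hm hl hl₀_int] at h1
    refine h1.trans ?_
    filter_upwards [h_cond] with ω hω
    simp [hω]
  have h2 : μ[(fun ω => (D ω - m₀ (X ω)) * (Y ω - l₀ (D ω) (X ω))) | m] =ᵐ[μ] 0 := by
    refine (condExp_mul_of_stronglyMeasurable_left hf h_int (hY_int.sub hl₀_int)).trans ?_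
    filter_upwards [hg] with ω hω
    simp [hω]
  refine (condExp_condExp_of_le hXm hm).symm.trans ?_
  refine (condExp_congr_ae h2).trans ?_
  rw [condExp_zero]
end

section
/- Let g : ℝ → E → ℝ be measurable such that for every x ∈ E and d ∈ ℝ, HasDerivAt (fun s => l₀ s x) (g d x) d, and such that ω ↦ g (D ω) (X ω) is μ-integrable. Let m, v : E → ℝ be measurable with v x ≠ 0 for all x and with ω ↦ ((D ω − m (X ω))/v (X ω)) · (Y ω − l₀ (D ω) (X ω)) μ-integrable. Define the Average Partial Effect θ₀ := ∫ g (D ω) (X ω) ∂μ. Then ∫ ( g (D ω) (X ω) − θ₀ + ((D ω − m (X ω))/v (X ω)) · (Y ω − l₀ (D ω) (X ω)) ) ∂μ = 0; i.e., the practical Neyman-orthogonal score is an unbiased moment function identifying the Average Partial Effect θ₀. -/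
open MeasureTheory

/-- Unbiasedness of the practical Neyman-orthogonal score at the truth: under the
conditional moment restriction `E[Y | D, X] = l₀(D, X)`, if `g` is the partial derivative
of the outcome model `l₀` in the treatment (so the Average Partial Effect is
`θ₀ = ∫ g (D ω) (X ω) ∂μ`), and `m, v : E → ℝ` are measurable with `v x ≠ 0` and the
correction term integrable, then the practical score has mean zero at `θ₀`:
`∫ ( g(D,X) - θ₀ + ((D - m(X))/v(X)) · (Y - l₀(D,X)) ) ∂μ = 0`. -/
theorem practical_APE_score_identifies_APE
    {Ω E : Type*} [MeasurableSpace Ω] [MeasurableSpace E]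
    (μ : Measure Ω) [IsProbabilityMeasure μ]
    (X : Ω → E) (D Y : Ω → ℝ)
    (hX : Measurable X) (hD : Measurable D) (hY : Measurable Y)
    (l₀ : ℝ → E → ℝ) (hl₀ : Measurable (Function.uncurry l₀))
    (hY_int : Integrable Y μ)
    (hl₀_int : Integrable (fun ω => l₀ (D ω) (X ω)) μ)
    (h_cond : μ[Y | MeasurableSpace.comap (fun ω => (D ω, X ω)) inferInstance]
        =ᵐ[μ] fun ω => l₀ (D ω) (X ω))
    (g : ℝ → E → ℝ) (hg : Measurable (Function.uncurry g))
    (hg_deriv : ∀ x : E, ∀ d : ℝ, HasDerivAt (fun s => l₀ s x) (g d x) d)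
    (hg_int : Integrable (fun ω => g (D ω) (X ω)) μ)
    (m v : E → ℝ) (hm : Measurable m) (hv : Measurable v)
    (hv_ne : ∀ x, v x ≠ 0)
    (h_corr_int : Integrable
      (fun ω => (D ω - m (X ω)) / v (X ω) * (Y ω - l₀ (D ω) (X ω))) μ) :
    ∫ ω, (g (D ω) (X ω) - (∫ ω', g (D ω') (X ω') ∂μ) +
      (D ω - m (X ω)) / v (X ω) * (Y ω - l₀ (D ω) (X ω))) ∂μ = 0 := by
  have hDX : Measurable (fun ω => (D ω, X ω)) := hD.prodMk hX
  have hle := hDX.comap_le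
  have hcomp : Measurable[MeasurableSpace.comap (fun ω => (D ω, X ω)) inferInstance]
      (fun ω => (D ω, X ω)) := comap_measurable _
  have hw : StronglyMeasurable[MeasurableSpace.comap (fun ω => (D ω, X ω)) inferInstance]
      (fun ω => (D ω - m (X ω)) / v (X ω)) := by
    have h : Measurable (fun p : ℝ × E => (p.1 - m p.2) / v p.2) := by fun_prop
    exact (h.comp hcomp).stronglyMeasurable
  have hl : StronglyMeasurable[MeasurableSpace.comap (fun ω => (D ω, X ω)) inferInstance]
      (fun ω => l₀ (D ω) (X ω)) := (hl₀.comp hcomp).stronglyMeasurable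
  have h1 := condExp_mul_of_stronglyMeasurable_left hw
    (g := Y - fun ω => l₀ (D ω) (X ω)) h_corr_int (hY_int.sub hl₀_int)
  have h2 := condExp_sub hY_int hl₀_int
    (MeasurableSpace.comap (fun ω => (D ω, X ω)) inferInstance)
  rw [condExp_of_stronglyMeasurable hle hl hl₀_int] at h2
  have h0 : ∫ ω, (D ω - m (X ω)) / v (X ω) * (Y ω - l₀ (D ω) (X ω)) ∂μ = 0 := by
    have h3 := integral_condExp (μ := μ) hle
      (f := (fun ω => (D ω - m (X ω)) / v (X ω)) * (Y - fun ω => l₀ (D ω) (X ω)))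
    refine h3.symm.trans ?_
    apply integral_eq_zero_of_ae
    filter_upwards [h1, h2, h_cond] with ω a b c
    rw [a, Pi.mul_apply, b, Pi.sub_apply, c]
    simp
  have h4 : Integrable (fun ω => g (D ω) (X ω) - (∫ ω', g (D ω') (X ω') ∂μ)) μ :=
    hg_int.sub (integrable_const _)
  rw [integral_add h4 h_corr_int, h0,
    integral_sub hg_int (integrable_const _)]
  simp
end

section
/- Let (Ω, 𝓕, μ) be a probability space, E a measurable space, X : Ω → E and D : Ω → ℝ measurable, and m, v : E → ℝ measurable with v x > 0 for all x. Assume the heteroskedastic Gaussian treatment model: Measure.map (fun ω => (D ω, X ω)) μ = (volume.prod (Measure.map X μ)).withDensity (fun q => ENNReal.ofReal (gaussianPDFReal (m q.2) (v q.2) q.1)). Let r : ℝ → E → ℝ be measurable such that for (Measure.map X μ)-a.e. x the section d ↦ r d x is differentiable with derivative ∂_d r, r d x · gaussianPDFReal (m x) (v x) d → 0 as d → +∞ and as d → −∞, the sections d ↦ (∂_d r) d x · gaussianPDFReal (m x) (v x) d and d ↦ ((d − m x)/v x) · r d x · gaussianPDFReal (m x) (v x) d are Lebesgue-integrable, and ω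 ↦ (∂_d r)(D ω, X ω) and ω ↦ ((D ω − m (X ω))/v (X ω)) · r (D ω) (X ω) are μ-integrable (with the corresponding (volume ⊗ Measure.map X μ)-integrability of the density-weighted integrands). Then ∫ (∂_d r)(D ω, X ω) ∂μ = ∫ ((D ω − m (X ω))/v (X ω)) · r (D ω) (X ω) ∂μ. (A conditional Stein identity: the Gaussian specialization of the integration-by-parts step of Proposition 1 used for the practical APE score.) -/
open MeasureTheory ProbabilityTheory Filter

lemma stein_transfer {Ω E : Type*} [MeasurableSpace Ω] [MeasurableSpace E]
    (μ : Measure Ω) [IsProbabilityMeasure μ] (X : Ω → E) (D : Ω → ℝ)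
    (hX : Measurable X) (hD : Measurable D)
    (g : ℝ × E → ℝ) (hg : Measurable g) (hg_pos : ∀ q, 0 < g q)
    (h_law : Measure.map (fun ω => (D ω, X ω)) μ =
      (volume.prod (Measure.map X μ)).withDensity (fun q => ENNReal.ofReal (g q)))
    (f : ℝ × E → ℝ)
    (hf : Integrable (fun q => f q * g q) (volume.prod (Measure.map X μ))) :
    ∫ ω, f (D ω, X ω) ∂μ = ∫ x, (∫ d, f (d, x) * g (d, x)) ∂(Measure.map X μ) := by
  have : IsProbabilityMeasure (Measure.map X μ) := Measure.isProbabilityMeasure_map hX.aemeasurable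
  have hfm : AEStronglyMeasurable f (volume.prod (Measure.map X μ)) := by
    have h := (hf.aestronglyMeasurable.aemeasurable.div hg.aemeasurable).aestronglyMeasurable
    refine h.congr (Eventually.of_forall fun q => ?_)
    simp [(hg_pos q).ne']
  have hfm2 : AEStronglyMeasurable f (Measure.map (fun ω => (D ω, X ω)) μ) := by
    rw [h_law]
    exact hfm.mono_ac (withDensity_absolutelyContinuous _ _)
  rw [← integral_map (φ := fun ω => (D ω, X ω)) (hD.prodMk hX).aemeasurable hfm2, h_law,
    integral_withDensity_eq_integral_toReal_smul hg.ennreal_ofReal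
      (Eventually.of_forall fun _ => ENNReal.ofReal_lt_top)]
  have h2 : ∀ q, (ENNReal.ofReal (g q)).toReal • f q = f q * g q := fun q => by
    rw [ENNReal.toReal_ofReal (hg_pos q).le, smul_eq_mul, mul_comm]
  simp_rw [h2]
  exact integral_prod_symm _ hf

lemma stein_hasDerivAt_pdf (m v d : ℝ) (hv : 0 < v) :
    HasDerivAt (gaussianPDFReal m v.toNNReal)
      (-((d - m) / v) * gaussianPDFReal m v.toNNReal d) d := by
  rw [gaussianPDFReal_def]
  have h1 : HasDerivAt (fun x : ℝ => -(x - m) ^ 2 / (2 * v)) (-((d - m) / v)) d := by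
    have h := ((((hasDerivAt_id d).sub_const m).pow 2).neg).div_const (2 * v)
    refine (h.congr_deriv ?_)
    simp
    field_simp
  have h2 := (h1.exp).const_mul (√(2 * Real.pi * v))⁻¹
  simp only [Real.coe_toNNReal _ hv.le]
  refine h2.congr_deriv ?_
  ring

/-- Conditional Stein identity (Gaussian specialization of the integration-by-parts step
of Proposition 1): if conditionally on `X` the treatment `D` is Gaussian with mean `m(X)`
and variance `v(X) > 0`, then for any sufficiently regular `r : ℝ → E → ℝ` with fiberwise
derivative `r'`, vanishing tails `r·gaussianPDF → 0` and the stated integrability,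
`E[ r'(D, X) ] = E[ ((D - m(X))/v(X)) · r(D, X) ]`. -/
theorem conditional_stein_identity
    {Ω E : Type*} [MeasurableSpace Ω] [MeasurableSpace E]
    (μ : Measure Ω) [IsProbabilityMeasure μ]
    (X : Ω → E) (D : Ω → ℝ)
    (hX : Measurable X) (hD : Measurable D)
    (m v : E → ℝ) (hm : Measurable m) (hv : Measurable v)
    (hv_pos : ∀ x, 0 < v x)
    (h_law : Measure.map (fun ω => (D ω, X ω)) μ =
      (volume.prod (Measure.map X μ)).withDensity
        (fun q => ENNReal.ofReal (gaussianPDFReal (m q.2) (v q.2).toNNReal q.1)))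
    (r r' : ℝ → E → ℝ)
    (hr_meas : Measurable (Function.uncurry r))
    (hr_diff : ∀ᵐ x ∂(Measure.map X μ), ∀ d : ℝ,
      HasDerivAt (fun s => r s x) (r' d x) d)
    (h_top : ∀ᵐ x ∂(Measure.map X μ),
      Tendsto (fun d => r d x * gaussianPDFReal (m x) (v x).toNNReal d) atTop (nhds 0))
    (h_bot : ∀ᵐ x ∂(Measure.map X μ),
      Tendsto (fun d => r d x * gaussianPDFReal (m x) (v x).toNNReal d) atBot (nhds 0))
    (h_sec1 : ∀ᵐ x ∂(Measure.map X μ),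
      Integrable (fun d => r' d x * gaussianPDFReal (m x) (v x).toNNReal d))
    (h_sec2 : ∀ᵐ x ∂(Measure.map X μ),
      Integrable (fun d => (d - m x) / v x * r d x * gaussianPDFReal (m x) (v x).toNNReal d))
    (h_int1 : Integrable (fun ω => r' (D ω) (X ω)) μ)
    (h_int2 : Integrable (fun ω => (D ω - m (X ω)) / v (X ω) * r (D ω) (X ω)) μ)
    (h_prod1 : Integrable
      (fun q : ℝ × E => r' q.1 q.2 * gaussianPDFReal (m q.2) (v q.2).toNNReal q.1)
      (volume.prod (Measure.map X μ)))
    (h_prod2 : Integrable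
      (fun q : ℝ × E =>
        (q.1 - m q.2) / v q.2 * r q.1 q.2 * gaussianPDFReal (m q.2) (v q.2).toNNReal q.1)
      (volume.prod (Measure.map X μ))) :
    ∫ ω, r' (D ω) (X ω) ∂μ =
      ∫ ω, (D ω - m (X ω)) / v (X ω) * r (D ω) (X ω) ∂μ := by
  have hvne : ∀ x, (v x).toNNReal ≠ 0 := fun x => (Real.toNNReal_pos.2 (hv_pos x)).ne'
  have hg : Measurable (fun q : ℝ × E => gaussianPDFReal (m q.2) (v q.2).toNNReal q.1) := by
    unfold gaussianPDFReal
    fun_prop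
  have hgp : ∀ q : ℝ × E, 0 < gaussianPDFReal (m q.2) (v q.2).toNNReal q.1 :=
    fun q => gaussianPDFReal_pos _ _ _ (hvne q.2)
  have e1 := stein_transfer μ X D hX hD _ hg hgp h_law (fun q => r' q.1 q.2) h_prod1
  have e2 := stein_transfer μ X D hX hD _ hg hgp h_law
    (fun q => (q.1 - m q.2) / v q.2 * r q.1 q.2) h_prod2
  simp only at e1 e2
  rw [e1, e2]
  refine integral_congr_ae ?_
  filter_upwards [hr_diff, h_top, h_bot, h_sec1, h_sec2] with x hd ht hb h1 h2
  have key := integral_of_hasDerivAt_of_tendsto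
    (f := fun d => r d x * gaussianPDFReal (m x) (v x).toNNReal d)
    (f' := fun d => r' d x * gaussianPDFReal (m x) (v x).toNNReal d
      - (d - m x) / v x * r d x * gaussianPDFReal (m x) (v x).toNNReal d)
    (fun d => by
      refine ((hd d).mul (stein_hasDerivAt_pdf (m x) (v x) d (hv_pos x))).congr_deriv ?_
      ring) (h1.sub h2) hb ht
  rw [integral_sub h1 h2] at key
  linarith
end

section
/- Assume in addition the heteroskedastic Gaussian treatment model: m, v : E → ℝ are measurable with v x > 0 for all x, and Measure.map (fun ω => (D ω, X ω)) μ = (volume.prod (Measure.map X μ)).withDensity (fun q => ENNReal.ofReal (gaussianPDFReal (m q.2) (v q.2) q.1)). Let r_l : ℝ → E → ℝ be measurable such that for (Measure.map X μ)-a.e. x the section d ↦ r_l d x is differentiable with derivative ∂_d r_l, r_l d x · gaussianPDFReal (m x) (v x) d → 0 as d → ±∞, and the integrability hypotheses of the conditional Stein identity hold for r_l. Let g : ℝ → E → ℝ be measurable (representing ∂_d l₀) and assume ω ↦ g (D ω) (X ω), ω ↦ ((D ω − m (X ω))/v (X ω)) · (Y ω − l₀ (D ω) (X ω)), ω ↦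 (∂_d r_l)(D ω, X ω), and ω ↦ ((D ω − m (X ω))/v (X ω)) · r_l (D ω) (X ω) are μ-integrable. Then for every θ₀ ∈ ℝ, the map t ↦ ∫ ( g (D ω) (X ω) + t · (∂_d r_l)(D ω, X ω) − θ₀ + ((D ω − m (X ω))/v (X ω)) · (Y ω − l₀ (D ω) (X ω) − t · r_l (D ω) (X ω)) ) ∂μ is constant in t; in particular its derivative at t = 0 is 0. (Neyman orthogonality of the practical APE score with respect to the outcome model l.) -/
open MeasureTheory ProbabilityTheory Filter

/-- The derivative of the Gaussian density. -/
lemma hasDerivAt_gaussianPDFReal_aux (m v : ℝ) (hv : 0 < v) (d : ℝ) :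
    HasDerivAt (fun s => gaussianPDFReal m v.toNNReal s)
      (-((d - m) / v) * gaussianPDFReal m v.toNNReal d) d := by
  unfold gaussianPDFReal
  rw [Real.coe_toNNReal v hv.le]
  have h1 : HasDerivAt (fun s : ℝ => -(s - m) ^ 2 / (2 * v)) (-((d - m) / v)) d := by
    have h := ((((hasDerivAt_id d).sub_const m).pow 2).neg).div_const (2 * v)
    refine HasDerivAt.congr_deriv (f := fun s : ℝ => -(s - m) ^ 2 / (2 * v)) h ?_
    simp
    field_simp
  refine ((h1.exp).const_mul ((√(2 * Real.pi * v))⁻¹)).congr_deriv ?_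
  ring

/-- One-dimensional Stein identity. -/
lemma stein_section_aux (m v : ℝ) (hv : 0 < v) (r r' : ℝ → ℝ)
    (hr : ∀ d, HasDerivAt r (r' d) d)
    (ht : Tendsto (fun d => r d * gaussianPDFReal m v.toNNReal d) atTop (nhds 0))
    (hb : Tendsto (fun d => r d * gaussianPDFReal m v.toNNReal d) atBot (nhds 0))
    (h1 : Integrable (fun d => r' d * gaussianPDFReal m v.toNNReal d))
    (h2 : Integrable (fun d => (d - m) / v * r d * gaussianPDFReal m v.toNNReal d)) :
    ∫ d, r' d * gaussianPDFReal m v.toNNReal d =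
      ∫ d, (d - m) / v * r d * gaussianPDFReal m v.toNNReal d := by
  have hder : ∀ d, HasDerivAt (fun d => r d * gaussianPDFReal m v.toNNReal d)
      (r' d * gaussianPDFReal m v.toNNReal d
        - (d - m) / v * r d * gaussianPDFReal m v.toNNReal d) d := by
    intro d
    refine ((hr d).mul (hasDerivAt_gaussianPDFReal_aux m v hv d)).congr_deriv ?_
    ring
  have h := integral_of_hasDerivAt_of_tendsto hder (h1.sub h2) hb ht
  rw [integral_sub h1 h2] at h
  linarith

/-- Neyman orthogonality of the practical APE score with respect to the outcome model `l`:
under the conditional moment restriction `E[Y | D, X] = l₀(D, X)` and the heteroskedastic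
Gaussian treatment model `D | X ~ N(m(X), v(X))`, for any perturbation direction `r_l` of
the outcome model (with fiberwise derivative `r_l'`, vanishing Gaussian-weighted tails and
the integrability hypotheses of the conditional Stein identity), the expected perturbed
practical score
`t ↦ E[ g(D,X) + t·r_l'(D,X) - θ₀ + ((D - m(X))/v(X))·(Y - l₀(D,X) - t·r_l(D,X)) ]`
is constant in `t`, and in particular its derivative at `t = 0` is `0`. -/
theorem practical_APE_score_orthogonal_outcome
    {Ω E : Type*} [MeasurableSpace Ω] [MeasurableSpace E]
    (μ : Measure Ω) [IsProbabilityMeasure μ]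
    (X : Ω → E) (D Y : Ω → ℝ)
    (hX : Measurable X) (hD : Measurable D) (hY : Measurable Y)
    (l₀ : ℝ → E → ℝ) (hl₀ : Measurable (Function.uncurry l₀))
    (hY_int : Integrable Y μ)
    (hl₀_int : Integrable (fun ω => l₀ (D ω) (X ω)) μ)
    (h_cond : μ[Y | MeasurableSpace.comap (fun ω => (D ω, X ω)) inferInstance]
        =ᵐ[μ] fun ω => l₀ (D ω) (X ω))
    (m v : E → ℝ) (hm : Measurable m) (hv : Measurable v)
    (hv_pos : ∀ x, 0 < v x)
    (h_law : Measure.map (fun ω => (D ω, X ω)) μ =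
      (volume.prod (Measure.map X μ)).withDensity
        (fun q => ENNReal.ofReal (gaussianPDFReal (m q.2) (v q.2).toNNReal q.1)))
    (r_l r_l' : ℝ → E → ℝ)
    (hr_meas : Measurable (Function.uncurry r_l))
    (hr_diff : ∀ᵐ x ∂(Measure.map X μ), ∀ d : ℝ,
      HasDerivAt (fun s => r_l s x) (r_l' d x) d)
    (h_top : ∀ᵐ x ∂(Measure.map X μ),
      Tendsto (fun d => r_l d x * gaussianPDFReal (m x) (v x).toNNReal d) atTop (nhds 0))
    (h_bot : ∀ᵐ x ∂(Measure.map X μ),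
      Tendsto (fun d => r_l d x * gaussianPDFReal (m x) (v x).toNNReal d) atBot (nhds 0))
    (h_sec1 : ∀ᵐ x ∂(Measure.map X μ),
      Integrable (fun d => r_l' d x * gaussianPDFReal (m x) (v x).toNNReal d))
    (h_sec2 : ∀ᵐ x ∂(Measure.map X μ),
      Integrable (fun d =>
        (d - m x) / v x * r_l d x * gaussianPDFReal (m x) (v x).toNNReal d))
    (h_prod1 : Integrable
      (fun q : ℝ × E => r_l' q.1 q.2 * gaussianPDFReal (m q.2) (v q.2).toNNReal q.1)
      (volume.prod (Measure.map X μ)))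
    (h_prod2 : Integrable
      (fun q : ℝ × E =>
        (q.1 - m q.2) / v q.2 * r_l q.1 q.2 *
          gaussianPDFReal (m q.2) (v q.2).toNNReal q.1)
      (volume.prod (Measure.map X μ)))
    (g : ℝ → E → ℝ) (hg : Measurable (Function.uncurry g))
    (hg_int : Integrable (fun ω => g (D ω) (X ω)) μ)
    (h_corr_int : Integrable
      (fun ω => (D ω - m (X ω)) / v (X ω) * (Y ω - l₀ (D ω) (X ω))) μ)
    (hr'_int : Integrable (fun ω => r_l' (D ω) (X ω)) μ)
    (hcorr_r_int : Integrable
      (fun ω => (D ω - m (X ω)) / v (X ω) * r_l (D ω) (X ω)) μ) :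
    ∀ θ₀ : ℝ,
      (∀ t : ℝ,
        (∫ ω, (g (D ω) (X ω) + t * r_l' (D ω) (X ω) - θ₀ +
          (D ω - m (X ω)) / v (X ω) *
            (Y ω - l₀ (D ω) (X ω) - t * r_l (D ω) (X ω))) ∂μ) =
        ∫ ω, (g (D ω) (X ω) - θ₀ +
          (D ω - m (X ω)) / v (X ω) * (Y ω - l₀ (D ω) (X ω))) ∂μ) ∧
      deriv (fun t : ℝ =>
        ∫ ω, (g (D ω) (X ω) + t * r_l' (D ω) (X ω) - θ₀ +
          (D ω - m (X ω)) / v (X ω) *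
            (Y ω - l₀ (D ω) (X ω) - t * r_l (D ω) (X ω))) ∂μ) 0 = 0 := by
  have hDX : Measurable (fun ω => (D ω, X ω)) := hD.prodMk hX
  have : IsProbabilityMeasure (Measure.map X μ) :=
    Measure.isProbabilityMeasure_map hX.aemeasurable
  have hpdf : Measurable
      (fun q : ℝ × E => gaussianPDFReal (m q.2) (v q.2).toNNReal q.1) := by
    unfold gaussianPDFReal
    fun_prop
  have hpos : ∀ q : ℝ × E, 0 < gaussianPDFReal (m q.2) (v q.2).toNNReal q.1 := fun q =>
    gaussianPDFReal_pos _ _ _ (by simpa using hv_pos q.2)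
  have key : ∀ f : ℝ × E → ℝ, Integrable
      (fun q : ℝ × E => f q * gaussianPDFReal (m q.2) (v q.2).toNNReal q.1)
      (volume.prod (Measure.map X μ)) →
      ∫ ω, f (D ω, X ω) ∂μ =
        ∫ x, (∫ d, f (d, x) * gaussianPDFReal (m x) (v x).toNNReal d) ∂(Measure.map X μ) := by
    intro f hf
    have hfm : AEStronglyMeasurable f (volume.prod (Measure.map X μ)) := by
      have h := hf.aestronglyMeasurable.mul (hpdf.inv).aestronglyMeasurable
      refine h.congr (Eventually.of_forall fun q => ?_)
      simp [(hpos q).ne']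
    have hfm' : AEStronglyMeasurable f (Measure.map (fun ω => (D ω, X ω)) μ) := by
      rw [h_law]
      exact hfm.mono_ac (withDensity_absolutelyContinuous _ _)
    rw [← integral_map hDX.aemeasurable hfm', h_law,
      integral_withDensity_eq_integral_toReal_smul hpdf.ennreal_ofReal
        (Eventually.of_forall fun _ => ENNReal.ofReal_lt_top), ← integral_prod_symm _ hf]
    refine integral_congr_ae (Eventually.of_forall fun q => ?_)
    simp [ENNReal.toReal_ofReal (hpos q).le, mul_comm]
  have stein : ∫ ω, r_l' (D ω) (X ω) ∂μ =
      ∫ ω, (D ω - m (X ω)) / v (X ω) * r_l (D ω) (X ω) ∂μ := by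
    rw [key (fun q => r_l' q.1 q.2) h_prod1,
      key (fun q => (q.1 - m q.2) / v q.2 * r_l q.1 q.2) h_prod2]
    refine integral_congr_ae ?_
    filter_upwards [hr_diff, h_top, h_bot, h_sec1, h_sec2] with x h1 h2 h3 h4 h5
    exact stein_section_aux (m x) (v x) (hv_pos x) _ _ h1 h2 h3 h4 h5
  intro θ₀
  have hconst : ∀ t : ℝ,
        (∫ ω, (g (D ω) (X ω) + t * r_l' (D ω) (X ω) - θ₀ +
          (D ω - m (X ω)) / v (X ω) *
            (Y ω - l₀ (D ω) (X ω) - t * r_l (D ω) (X ω))) ∂μ) =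
        ∫ ω, (g (D ω) (X ω) - θ₀ +
          (D ω - m (X ω)) / v (X ω) * (Y ω - l₀ (D ω) (X ω))) ∂μ := by
    intro t
    have hA : Integrable (fun ω => g (D ω) (X ω) - θ₀ +
          (D ω - m (X ω)) / v (X ω) * (Y ω - l₀ (D ω) (X ω))) μ :=
      (hg_int.sub (integrable_const θ₀)).add h_corr_int
    have hB : Integrable (fun ω => t * (r_l' (D ω) (X ω) -
          (D ω - m (X ω)) / v (X ω) * r_l (D ω) (X ω))) μ :=
      (hr'_int.sub hcorr_r_int).const_mul t
    have hB0 : ∫ ω, t * (r_l' (D ω) (X ω) -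
          (D ω - m (X ω)) / v (X ω) * r_l (D ω) (X ω)) ∂μ = 0 := by
      rw [integral_const_mul, integral_sub hr'_int hcorr_r_int, stein, sub_self, mul_zero]
    have hadd := integral_add hA hB
    rw [hB0, add_zero] at hadd
    rw [← hadd]
    congr 1
    funext ω
    ring
  refine ⟨hconst, ?_⟩
  rw [funext hconst]
  exact deriv_const _ _
end
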